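/- arXiv:1201.3550 — 11 statements merged into one kernel-verified Lean document; each statement's English description precedes it below -/
import Mathlib

section
/- Let l0 be a real number. For each k ∈ ℕ, let γ_k > 0 satisfy γ_k·(α12 + α21) < 1, let n_k ∈ ℕ, and let l^(k) : ℕ → ℝ satisfy the mean-difference recurrence with parameter γ_k and initial value l^(k)(0) = l0. If γ_k → 0 and n_k·γ_k → ∞ as k → ∞, then l^(k)(n_k) → (v1 − v2)/(α12 + α21). -/
open Filter Topology

/-- Discrete-time form of Theorem 1 (mean differences): if `γ k → 0` and
`n k * γ k → ∞`, then the solution of the mean-difference recurrence tends to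
`(v1 - v2)/(α12 + α21)`. -/
theorem mean_difference_limit
    (α12 α21 v1 v2 l0 : ℝ)
    (hα12 : 0 < α12) (hα21 : 0 < α21) (hv : v1 < v2)
    (γ : ℕ → ℝ) (hγpos : ∀ k, 0 < γ k)
    (hγlt : ∀ k, γ k * (α12 + α21) < 1)
    (n : ℕ → ℕ)
    (l : ℕ → ℕ → ℝ)
    (hrec : ∀ k m, l k (m + 1) =
      (1 - γ k * (α12 + α21)) * l k m
        + γ k * (v1 - v2) * (1 - γ k * (α12 + α21)))
    (hinit : ∀ k, l k 0 = l0)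
    (hγ0 : Tendsto γ atTop (𝓝 0))
    (hnγ : Tendsto (fun k => (n k : ℝ) * γ k) atTop atTop) :
    Tendsto (fun k => l k (n k)) atTop (𝓝 ((v1 - v2) / (α12 + α21))) := by
  have ha : 0 < α12 + α21 := by linarith
  generalize α12 + α21 = a at *
  have hR : Tendsto (fun k => 1 - γ k * a) atTop (𝓝 1) := by
    simpa using (hγ0.mul_const a).const_sub 1
  have hc : Tendsto (fun k => (v1 - v2) / a * (1 - γ k * a)) atTop (𝓝 ((v1 - v2) / a)) := by
    simpa using hR.const_mul ((v1 - v2) / a)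
  have hsol : ∀ k m, l k m = (v1 - v2) / a * (1 - γ k * a)
      + (1 - γ k * a) ^ m * (l0 - (v1 - v2) / a * (1 - γ k * a)) := by
    intro k m
    induction m with
    | zero => rw [hinit]; ring
    | succ m ih =>
      rw [hrec, ih]
      field_simp
      ring
  have hpow : Tendsto (fun k => (1 - γ k * a) ^ (n k)) atTop (𝓝 0) := by
    have hexp : Tendsto (fun k => Real.exp (-((n k : ℝ) * γ k * a))) atTop (𝓝 0) :=
      Real.tendsto_exp_neg_atTop_nhds_zero.comp (hnγ.atTop_mul_const ha)
    refine squeeze_zero (fun k => pow_nonneg (by linarith [hγlt k]) _) (fun k => ?_) hexp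
    have h1 : 1 - γ k * a ≤ Real.exp (-(γ k * a)) := Real.one_sub_le_exp_neg _
    calc (1 - γ k * a) ^ (n k) ≤ Real.exp (-(γ k * a)) ^ (n k) :=
          pow_le_pow_left₀ (by linarith [hγlt k]) h1 _
      _ = Real.exp (-((n k : ℝ) * γ k * a)) := by
          rw [← Real.exp_nat_mul]; congr 1; ring
  have hfin := hc.add (hpow.mul (hc.const_sub l0))
  simp only [zero_mul, add_zero] at hfin
  exact hfin.congr (fun k => (hsol k (n k)).symm)
end

section
/- Let a1, a2 be real numbers. For each k ∈ ℕ, let γ_k > 0, let n_k ∈ ℕ, and let μ1^(k), μ2^(k) : ℕ → ℝ satisfy the closed mean system with parameter γ_k and initial values μ1^(k)(0) = a1, μ2^(k)(0) = a2. If γ_k → 0 and n_k·γ_k → ∞ as k → ∞, then for both i = 1 and i = 2, μ_i^(k)(n_k)/(n_k·γ_k) → (α12·v2 + α21·v1)/(α12 + α21). -/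
open Filter Topology

/-- Discrete-time form of Theorem 1 (empirical means): if `γ k → 0` and
`n k * γ k → ∞`, then `μ i (n k) / (n k * γ k)` tends to
`(α12 v2 + α21 v1)/(α12 + α21)` for both types `i = 1, 2`. -/
theorem mean_growth_rate_limit
    (α12 α21 v1 v2 a1 a2 : ℝ)
    (hα12 : 0 < α12) (hα21 : 0 < α21) (hv : v1 < v2)
    (γ : ℕ → ℝ) (hγpos : ∀ k, 0 < γ k)
    (n : ℕ → ℕ)
    (μ1 μ2 : ℕ → ℕ → ℝ)
    (hrec1 : ∀ k m, μ1 k (m + 1) =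
      μ1 k m + (α12 * (μ2 k m - μ1 k m) + v1) * γ k
        + α12 * (v2 - v1) * (γ k) ^ 2)
    (hrec2 : ∀ k m, μ2 k (m + 1) =
      μ2 k m + (α21 * (μ1 k m - μ2 k m) + v2) * γ k
        + α21 * (v1 - v2) * (γ k) ^ 2)
    (hinit1 : ∀ k, μ1 k 0 = a1) (hinit2 : ∀ k, μ2 k 0 = a2)
    (hγ0 : Tendsto γ atTop (𝓝 0))
    (hnγ : Tendsto (fun k => (n k : ℝ) * γ k) atTop atTop) :
    Tendsto (fun k => μ1 k (n k) / ((n k : ℝ) * γ k)) atTop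
        (𝓝 ((α12 * v2 + α21 * v1) / (α12 + α21))) ∧
    Tendsto (fun k => μ2 k (n k) / ((n k : ℝ) * γ k)) atTop
        (𝓝 ((α12 * v2 + α21 * v1) / (α12 + α21))) := by
  have hs : 0 < α12 + α21 := by linarith
  have hS : ∀ k m, α21 * μ1 k m + α12 * μ2 k m =
      (α21 * a1 + α12 * a2) + (α12 * v2 + α21 * v1) * ((m : ℝ) * γ k) := by
    intro k m
    induction m with
    | zero => simp [hinit1, hinit2]
    | succ m ih =>
      rw [hrec1, hrec2]
      push_cast
      linear_combination ih
  obtain ⟨C, hC⟩ : ∃ C, C = |a2 - a1| + (v2 - v1) / (α12 + α21) := ⟨_, rfl⟩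
  have hCw : v2 - v1 ≤ (α12 + α21) * C := by
    have h1 : (α12 + α21) * ((v2 - v1) / (α12 + α21)) = v2 - v1 := by field_simp
    have h2 := mul_nonneg hs.le (abs_nonneg (a2 - a1))
    rw [hC, mul_add, h1]
    linarith
  have hD : ∀ k, (α12 + α21) * γ k ≤ 1 → ∀ m, |μ2 k m - μ1 k m| ≤ C := by
    intro k hk m
    induction m with
    | zero =>
      rw [hinit1, hinit2, hC]
      have : 0 ≤ (v2 - v1) / (α12 + α21) := div_nonneg (by linarith) hs.le
      linarith
    | succ m ih =>
      have e : μ2 k (m+1) - μ1 k (m+1) = (1 - (α12 + α21) * γ k) *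
          ((μ2 k m - μ1 k m) + (v2 - v1) * γ k) := by
        rw [hrec1, hrec2]; ring
      have hg := hγpos k
      have h0 : 0 ≤ 1 - (α12 + α21) * γ k := by linarith
      have hw : 0 ≤ (v2 - v1) * γ k := mul_nonneg (by linarith) hg.le
      rw [e, abs_mul, abs_of_nonneg h0]
      have h1 : |(μ2 k m - μ1 k m) + (v2 - v1) * γ k| ≤ C + (v2 - v1) * γ k := by
        refine (abs_add_le _ _).trans ?_
        rw [abs_of_nonneg hw]; linarith
      refine (mul_le_mul_of_nonneg_left h1 h0).trans ?_
      have h2 := mul_le_mul_of_nonneg_right hCw hg.le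
      have h3 : 0 ≤ (α12 + α21) * γ k * ((v2 - v1) * γ k) :=
        mul_nonneg (mul_nonneg hs.le hg.le) hw
      nlinarith
  have hev : ∀ᶠ k in atTop, (α12 + α21) * γ k ≤ 1 := by
    have h := hγ0.const_mul (α12 + α21)
    rw [mul_zero] at h
    exact h.eventually_le_const one_pos
  have hpos := hnγ.eventually_gt_atTop 0
  have hDlim : Tendsto (fun k => (μ2 k (n k) - μ1 k (n k)) / ((n k : ℝ) * γ k)) atTop (𝓝 0) := by
    refine squeeze_zero_norm' ?_ (hnγ.const_div_atTop C)
    filter_upwards [hev, hpos] with k h1 h2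
    rw [Real.norm_eq_abs, abs_div, abs_of_pos h2]
    exact div_le_div_of_nonneg_right (hD k h1 _) h2.le
  have hSlim := hnγ.const_div_atTop ((α21 * a1 + α12 * a2) / (α12 + α21))
  have key : ∀ c : ℝ, Tendsto (fun k => (α12 * v2 + α21 * v1) / (α12 + α21) +
      (α21 * a1 + α12 * a2) / (α12 + α21) / ((n k : ℝ) * γ k) +
      c * ((μ2 k (n k) - μ1 k (n k)) / ((n k : ℝ) * γ k))) atTop
      (𝓝 ((α12 * v2 + α21 * v1) / (α12 + α21))) := by
    intro c
    simpa using (hSlim.const_add ((α12 * v2 + α21 * v1) / (α12 + α21))).add (hDlim.const_mul c)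
  constructor
  · refine (key (-(α12 / (α12 + α21)))).congr' ?_
    filter_upwards [hpos] with k h2
    have h := hS k (n k)
    generalize (n k : ℝ) * γ k = t at *
    have := h2.ne'
    field_simp
    linear_combination -h
  · refine (key (α21 / (α12 + α21))).congr' ?_
    filter_upwards [hpos] with k h2
    have h := hS k (n k)
    generalize (n k : ℝ) * γ k = t at *
    have := h2.ne'
    field_simp
    linear_combination -h
end

section
/- Let t : ℕ → ℝ be a sequence with t(N) > 0 for all N, t(N) → ∞ and t(N)/N → 0 as N → ∞. For each N with Δ·N² > κ2 set σ(N) = 1 − κ2/(Δ·N²). Then N·(1 − σ(N)^⌊Δ·N·t(N)⌋) / (κ2·t(N)) → 1 as N → ∞. -/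
open Filter Topology

/-- First regime of Theorem 2: if `t N → ∞` and `t N / N → 0`, then
`N * (1 - σ(N) ^ ⌊Δ N t(N)⌋) / (κ2 * t(N)) → 1`. -/
theorem variance_subcritical_regime
    (α12 α21 c1 c2 Δ Z κ2 : ℝ)
    (hα12 : 0 < α12) (hα21 : 0 < α21)
    (hc1 : 0 < c1) (hc2 : 0 < c2) (hc : c1 + c2 = 1)
    (hΔ : Δ = c1 * α12 + c2 * α21)
    (hZ : Z = (α12 + α21) * (1 / α12 + 1 / α21))
    (hκ2 : κ2 = (2 / Z) * (α21 / c1 + α12 / c2))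
    (t : ℕ → ℝ) (htpos : ∀ N, 0 < t N)
    (htinf : Tendsto t atTop atTop)
    (htN : Tendsto (fun N => t N / (N : ℝ)) atTop (𝓝 0))
    (σ : ℕ → ℝ)
    (hσ : ∀ N : ℕ, Δ * (N : ℝ) ^ 2 > κ2 → σ N = 1 - κ2 / (Δ * (N : ℝ) ^ 2)) :
    Tendsto (fun N : ℕ => (N : ℝ) * (1 - σ N ^ ⌊Δ * (N : ℝ) * t N⌋₊) / (κ2 * t N))
      atTop (𝓝 1) := by
  have hΔ0 : 0 < Δ := by rw [hΔ]; positivity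
  have hZ0 : 0 < Z := by rw [hZ]; positivity
  have hκ0 : 0 < κ2 := by rw [hκ2]; positivity
  clear hΔ hZ hκ2
  have hNinf : Tendsto (fun N : ℕ => (N : ℝ)) atTop atTop := tendsto_natCast_atTop_atTop
  have hlow : Tendsto (fun N : ℕ => (1 - (Δ * ((N : ℝ) * t N))⁻¹) / (1 + κ2 * (t N / (N : ℝ))))
      atTop (𝓝 1) := by
    have h1 : Tendsto (fun N : ℕ => (Δ * ((N : ℝ) * t N))⁻¹) atTop (𝓝 0) :=
      tendsto_inv_atTop_zero.comp ((hNinf.atTop_mul_atTop₀ htinf).const_mul_atTop hΔ0)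
    have h2 := (h1.const_sub 1).div ((htN.const_mul κ2).const_add 1) (by simp)
    rw [mul_zero, add_zero, sub_zero, div_one] at h2
    exact h2
  have hbig : ∀ᶠ N : ℕ in atTop, 1 ≤ (N : ℝ) ∧ κ2 / Δ < (N : ℝ) :=
    (hNinf.eventually_ge_atTop 1).and (hNinf.eventually_gt_atTop (κ2 / Δ))
  have key : ∀ᶠ N : ℕ in atTop,
      (1 - (Δ * ((N : ℝ) * t N))⁻¹) / (1 + κ2 * (t N / (N : ℝ))) ≤
        (N : ℝ) * (1 - σ N ^ ⌊Δ * (N : ℝ) * t N⌋₊) / (κ2 * t N) ∧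
      (N : ℝ) * (1 - σ N ^ ⌊Δ * (N : ℝ) * t N⌋₊) / (κ2 * t N) ≤ 1 := by
    filter_upwards [hbig] with N hN
    obtain ⟨hN1, hN2⟩ := hN
    have hgt : Δ * (N : ℝ) ^ 2 > κ2 := by
      rw [div_lt_iff₀ hΔ0] at hN2
      nlinarith [mul_le_mul_of_nonneg_left hN1 (mul_pos hΔ0 (by linarith : (0:ℝ) < N)).le]
    rw [hσ N hgt]
    have ht := htpos N
    set n : ℝ := (N : ℝ) with hn
    have hn0 : 0 < n := by linarith
    set m : ℕ := ⌊Δ * n * t N⌋₊ with hm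
    have hm1 : (m : ℝ) ≤ Δ * n * t N := Nat.floor_le (by positivity)
    have hm2 : Δ * n * t N - 1 ≤ (m : ℝ) := by
      have := Nat.lt_floor_add_one (Δ * n * t N)
      linarith
    set x : ℝ := κ2 / (Δ * n ^ 2) with hx
    have hx0 : 0 < x := by positivity
    have hx1 : x < 1 := by rw [hx, div_lt_one (by positivity)]; exact hgt
    set y : ℝ := κ2 * (t N / n) with hy
    have hy0 : 0 < y := by positivity
    have hxy : Δ * n * t N * x = y := by rw [hx, hy]; field_simp
    have hmx1 : m * x ≤ y := by rw [← hxy]; gcongr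
    have hmx2 : y - x ≤ m * x := by
      rw [← hxy]; nlinarith [mul_le_mul_of_nonneg_right hm2 hx0.le]
    have hmx0 : 0 ≤ m * x := by positivity
    have hb1 : 1 - m * x ≤ (1 - x) ^ m := by
      have := one_add_mul_le_pow (a := -x) (by linarith) m
      calc 1 - m * x = 1 + m * (-x) := by ring
        _ ≤ _ := this
        _ = _ := by rw [← sub_eq_add_neg]
    have hb2 : 1 + m * x ≤ (1 + x) ^ m := one_add_mul_le_pow (by linarith) m
    have hp0 : 0 ≤ (1 - x) ^ m := pow_nonneg (by linarith) m
    have hb3 : (1 - x) ^ m * (1 + m * x) ≤ 1 := by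
      calc (1 - x) ^ m * (1 + m * x) ≤ (1 - x) ^ m * (1 + x) ^ m := by gcongr
        _ = ((1 - x) * (1 + x)) ^ m := (mul_pow _ _ _).symm
        _ ≤ 1 := pow_le_one₀ (mul_nonneg (by linarith) (by linarith)) (by nlinarith)
    have e1 : n * (1 - (1 - x) ^ m) / (κ2 * t N) = (1 - (1 - x) ^ m) / y := by
      rw [hy]; field_simp
    have e2 : (Δ * (n * t N))⁻¹ = x / y := by rw [hx, hy]; field_simp
    rw [e1, e2]
    set p := (1 - x) ^ m
    have hp1 : p ≤ 1 := pow_le_one₀ (by linarith) (by linarith)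
    constructor
    · have : (1 - x / y) / (1 + y) = ((y - x) / (1 + y)) / y := by field_simp
      rw [this]
      gcongr
      rw [div_le_iff₀ (by positivity)]
      nlinarith [mul_le_mul_of_nonneg_left hmx1 (sub_nonneg.2 hp1)]
    · rw [div_le_one hy0]; linarith
  exact tendsto_of_tendsto_of_tendsto_of_le_of_le' hlow tendsto_const_nhds
    (key.mono fun _ h => h.1) (key.mono fun _ h => h.2)
end

section
/- Let N1, N2 be positive natural numbers, let x : Fin N1 → ℝ and y : Fin N2 → ℝ, and set γ = 1/(N1·α12 + N2·α21), X̄ = (1/N1)·Σ_i x(i), Ȳ = (1/N2)·Σ_j y(j). Then Σ_{k ∈ Fin N1} Σ_{j ∈ Fin N2} (α12·γ/N2)·[ ((Σ_{i ≠ k} x(i)) + y(j))/N1 + ((N1 − 1)·v1 + v2)·γ/N1 ] + N2·α21·γ·(X̄ + v1·γ) = X̄ + [α12·(Ȳ − X̄) + v1]·γ + α12·(v2 − v1)·γ². -/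
open Finset

/-- One-step closed equation for the expected empirical mean of type-1
particles in the embedded jump chain. -/
theorem one_step_mean_identity
    (α12 α21 v1 v2 : ℝ)
    (hα12 : 0 < α12) (hα21 : 0 < α21) (hv : v1 < v2)
    (N1 N2 : ℕ) (hN1 : 0 < N1) (hN2 : 0 < N2)
    (x : Fin N1 → ℝ) (y : Fin N2 → ℝ)
    (γ Xbar Ybar : ℝ)
    (hγ : γ = 1 / ((N1 : ℝ) * α12 + (N2 : ℝ) * α21))
    (hX : Xbar = (1 / (N1 : ℝ)) * ∑ i, x i)
    (hY : Ybar = (1 / (N2 : ℝ)) * ∑ j, y j) :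
    (∑ k : Fin N1, ∑ j : Fin N2,
        (α12 * γ / (N2 : ℝ)) *
          (((∑ i ∈ Finset.univ.erase k, x i) + y j) / (N1 : ℝ)
            + (((N1 : ℝ) - 1) * v1 + v2) * γ / (N1 : ℝ)))
      + (N2 : ℝ) * α21 * γ * (Xbar + v1 * γ)
    = Xbar + (α12 * (Ybar - Xbar) + v1) * γ + α12 * (v2 - v1) * γ ^ 2 := by
  have h1 : (0 : ℝ) < N1 := by exact_mod_cast hN1
  have h2 : (0 : ℝ) < N2 := by exact_mod_cast hN2
  have hD : (N1 : ℝ) * α12 + (N2 : ℝ) * α21 ≠ 0 := by positivity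
  have hg : (N2 : ℝ) * α21 * γ = 1 - N1 * α12 * γ := by
    rw [hγ]
    field_simp
    ring
  have hS : ∑ i, x i = N1 * Xbar := by
    rw [hX]
    field_simp
  have hT : ∑ j, y j = N2 * Ybar := by
    rw [hY]
    field_simp
  have he : ∀ k : Fin N1, ∑ i ∈ Finset.univ.erase k, x i = N1 * Xbar - x k := by
    intro k
    rw [← hS, ← Finset.sum_erase_add _ _ (Finset.mem_univ k)]
    ring
  have hsum : (∑ k : Fin N1, ∑ j : Fin N2,
        (α12 * γ / (N2 : ℝ)) *
          (((∑ i ∈ Finset.univ.erase k, x i) + y j) / (N1 : ℝ)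
            + (((N1 : ℝ) - 1) * v1 + v2) * γ / (N1 : ℝ)))
      = α12 * γ * ((N1 - 1) * Xbar + Ybar + ((N1 - 1) * v1 + v2) * γ) := by
    simp only [he, ← Finset.mul_sum, Finset.sum_add_distrib, ← Finset.sum_div,
      Finset.sum_sub_distrib, Finset.sum_const, Finset.card_univ, Fintype.card_fin,
      nsmul_eq_mul, hS, hT]
    field_simp
  rw [hsum, hg]
  ring
end

section
/- If μ1, μ2 : ℕ → ℝ satisfy the closed mean system with parameter γ > 0, then for every n ≥ 0: α21·μ1(n) + α12·μ2(n) = α21·μ1(0) + α12·μ2(0) + n·γ·(α21·v1 + α12·v2). -/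
/-- The weighted sum `α21·μ1 + α12·μ2` grows linearly along the closed mean
system. -/
theorem weighted_mean_linear_growth
    (α12 α21 v1 v2 γ : ℝ)
    (hα12 : 0 < α12) (hα21 : 0 < α21) (hv : v1 < v2) (hγ : 0 < γ)
    (μ1 μ2 : ℕ → ℝ)
    (hrec1 : ∀ n, μ1 (n + 1) =
      μ1 n + (α12 * (μ2 n - μ1 n) + v1) * γ + α12 * (v2 - v1) * γ ^ 2)
    (hrec2 : ∀ n, μ2 (n + 1) =
      μ2 n + (α21 * (μ1 n - μ2 n) + v2) * γ + α21 * (v1 - v2) * γ ^ 2) :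
    ∀ n : ℕ, α21 * μ1 n + α12 * μ2 n =
      α21 * μ1 0 + α12 * μ2 0 + (n : ℝ) * γ * (α21 * v1 + α12 * v2) := by
  intro n
  induction n with
  | zero => simp
  | succ k ih =>
    rw [hrec1 k, hrec2 k]
    push_cast
    linear_combination ih
end

section
/- There exist a constant C > 0, a natural number N0, and functions λ1, λ3 assigning to each natural number N ≥ N0 real eigenvalues λ1(N) and λ3(N) of the matrix B(N), such that for all N ≥ N0: |λ1(N) + (α12 + α21)| ≤ C/N and |λ3(N) + 2(α12 + α21)| ≤ C/N. -/
open Matrix Filter Topology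

lemma pert_root (g q h : ℝ → ℝ) (hg : Continuous g) (hq : Continuous q) (x0 k r : ℝ)
    (hk : 0 < k) (hr : 0 < r) (hgh : ∀ t, g (x0 + t) = t * h t)
    (hh : ∀ t, |t| ≤ r → k ≤ h t) :
    ∃ C > (0 : ℝ), ∃ N0 : ℕ, 1 ≤ N0 ∧ ∀ N : ℕ, N0 ≤ N →
      ∃ x, g x + (1 / (N : ℝ)) * q x = 0 ∧ |x - x0| ≤ C / N := by
  obtain ⟨M, hM⟩ := (isCompact_Icc (a := x0 - r) (b := x0 + r)).exists_bound_of_continuousOn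
    hq.continuousOn
  have hM0 : 0 ≤ M := (norm_nonneg _).trans (hM x0 ⟨by linarith, by linarith⟩)
  obtain ⟨n, hn⟩ := exists_nat_gt ((M + 1) / k / r)
  refine ⟨(M + 1) / k, by positivity, n + 1, by omega, fun N hN => ?_⟩
  have hNn : (n : ℝ) + 1 ≤ N := by exact_mod_cast hN
  have hNpos : (0 : ℝ) < N := by have : (0 : ℝ) ≤ n := n.cast_nonneg
                                 linarith
  set d : ℝ := (M + 1) / k / N with hd
  have hd0 : 0 < d := by positivity
  have hdr : d ≤ r := by
    rw [hd, div_le_iff₀ hNpos]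
    rw [div_lt_iff₀ hr] at hn
    nlinarith
  have hdk : d * k = (1 / (N : ℝ)) * (M + 1) := by rw [hd]; field_simp
  have hN1 : 0 < 1 / (N : ℝ) := by positivity
  have hcont : ContinuousOn (fun x => g x + (1 / (N : ℝ)) * q x) (Set.Icc (x0 + -d) (x0 + d)) := by
    fun_prop
  have key := intermediate_value_Icc (by linarith) hcont
  have q1 := hM (x0 + -d) ⟨by linarith, by linarith⟩
  have q2 := hM (x0 + d) ⟨by linarith, by linarith⟩
  rw [Real.norm_eq_abs, abs_le] at q1 q2
  have h1 := hh (-d) (by rw [abs_neg, abs_of_pos hd0]; exact hdr)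
  have h2 := hh d (by rw [abs_of_pos hd0]; exact hdr)
  obtain ⟨x, hx, hx0⟩ := key (show (0 : ℝ) ∈ _ from by
    constructor
    · simp only [hgh]
      have := mul_le_mul_of_nonneg_left h1 hd0.le
      have := mul_le_mul_of_nonneg_left q1.2 hN1.le
      linarith
    · simp only [hgh]
      have := mul_le_mul_of_nonneg_left h2 hd0.le
      have := mul_le_mul_of_nonneg_left q2.1 hN1.le
      linarith)
  exact ⟨x, hx0, by rw [abs_le]; constructor <;> linarith [hx.1, hx.2]⟩

lemma eig_of_det (A : Matrix (Fin 3) (Fin 3) ℝ) (x : ℝ) (h : (A - x • 1).det = 0) :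
    ∃ u : Fin 3 → ℝ, u ≠ 0 ∧ A *ᵥ u = x • u := by
  obtain ⟨u, hu, h⟩ := Matrix.exists_mulVec_eq_zero_iff.2 h
  refine ⟨u, hu, ?_⟩
  rw [Matrix.sub_mulVec, Matrix.smul_mulVec, Matrix.one_mulVec, sub_eq_zero] at h
  exact h

/-- The perturbed eigenvalues `λ1(N)`, `λ3(N)` of `B(N)` are within `C/N` of
`-(α12+α21)` and `-2(α12+α21)` respectively. -/
theorem perturbed_eigenvalues_lambda1_lambda3
    (α12 α21 c1 c2 : ℝ)
    (hα12 : 0 < α12) (hα21 : 0 < α21)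
    (hc1 : 0 < c1) (hc2 : 0 < c2) (hc : c1 + c2 = 1)
    (B1 B2 : Matrix (Fin 3) (Fin 3) ℝ)
    (hB1 : B1 = !![-α12, α12, α12; α21, -α21, α21; 0, 0, -2 * (α12 + α21)])
    (hB2 : B2 = !![-α12 / c1, -α12 / c1, -α12 / c1;
                   -α21 / c2, -α21 / c2, -α21 / c2;
                   α12 / c1 + α21 / c2, α12 / c1 + α21 / c2, α12 / c1 + α21 / c2])
    (B : ℕ → Matrix (Fin 3) (Fin 3) ℝ)
    (hB : ∀ N : ℕ, 1 ≤ N → B N = B1 + (1 / (N : ℝ)) • B2) :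
    ∃ C > (0 : ℝ), ∃ N0 : ℕ, ∃ lam1 lam3 : ℕ → ℝ,
      ∀ N : ℕ, N0 ≤ N →
        (∃ u : Fin 3 → ℝ, u ≠ 0 ∧ B N *ᵥ u = lam1 N • u) ∧
        (∃ u : Fin 3 → ℝ, u ≠ 0 ∧ B N *ᵥ u = lam3 N • u) ∧
        |lam1 N + (α12 + α21)| ≤ C / N ∧
        |lam3 N + 2 * (α12 + α21)| ≤ C / N := by
  set s := α12 + α21 with hs
  have hs0 : 0 < s := by positivity
  set g : ℝ → ℝ := fun x => x * (x + s) * (x + 2 * s) with hg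
  set q : ℝ → ℝ := fun x => g x + (B1 + B2 - x • 1).det with hq
  have hgc : Continuous g := by fun_prop
  have hqc : Continuous q := by
    refine hgc.add (Continuous.matrix_det ?_)
    fun_prop
  have hdet : ∀ e x : ℝ, (B1 + e • B2 - x • 1).det = -g x + e * q x := by
    intro e x
    simp only [hq, hg, hB1, hB2, hs, Matrix.det_fin_three]
    simp [Matrix.one_apply]
    ring
  obtain ⟨C1, hC1, N1, hN1, H1⟩ := pert_root (fun x => -g x) q (fun t => s ^ 2 - t ^ 2)
    hgc.neg hqc (-s) (s ^ 2 / 2) (s / 2) (by positivity) (by positivity)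
    (fun t => by simp only [hg]; ring)
    (fun t ht => by rw [abs_le] at ht; nlinarith)
  obtain ⟨C3, hC3, N3, hN3, H3⟩ := pert_root g (fun x => -q x) (fun t => (2 * s - t) * (s - t))
    hgc hqc.neg (-2 * s) (s ^ 2 / 2) (s / 2) (by positivity) (by positivity)
    (fun t => by simp only [hg]; ring)
    (fun t ht => by rw [abs_le] at ht; nlinarith)
  choose! l1 h1 using H1
  choose! l3 h3 using H3
  refine ⟨C1 + C3, by positivity, max N1 N3, l1, l3, fun N hN => ?_⟩
  have a1 := h1 N (le_trans (le_max_left _ _) hN)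
  have a3 := h3 N (le_trans (le_max_right _ _) hN)
  have hN' : 1 ≤ N := hN1.trans (le_trans (le_max_left _ _) hN)
  have e1 : C1 / (N : ℝ) ≤ (C1 + C3) / N := by gcongr; linarith
  have e3 : C3 / (N : ℝ) ≤ (C1 + C3) / N := by gcongr; linarith
  refine ⟨eig_of_det _ _ ?_, eig_of_det _ _ ?_, ?_, ?_⟩
  · rw [hB N hN', hdet]; exact a1.1
  · rw [hB N hN', hdet]; linarith [a3.1]
  · refine le_trans (le_of_eq ?_) (a1.2.trans e1)
    congr 1; ring
  · refine le_trans (le_of_eq ?_) (a3.2.trans e3)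
    congr 1; ring
end

section
/- There exist a natural number N0 and a function λ2 assigning to each natural number N ≥ N0 a real eigenvalue λ2(N) of the matrix B(N), such that N·λ2(N) → −κ2 as N → ∞. -/
open Matrix Filter Topology

/-- The perturbed zero eigenvalue `λ2(N)` of `B(N)` satisfies
`N·λ2(N) → -κ2`. -/
theorem perturbed_eigenvalue_lambda2
    (α12 α21 c1 c2 Z κ2 : ℝ)
    (hα12 : 0 < α12) (hα21 : 0 < α21)
    (hc1 : 0 < c1) (hc2 : 0 < c2) (hc : c1 + c2 = 1)
    (hZ : Z = (α12 + α21) * (1 / α12 + 1 / α21))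
    (hκ2 : κ2 = (2 / Z) * (α21 / c1 + α12 / c2))
    (B1 B2 : Matrix (Fin 3) (Fin 3) ℝ)
    (hB1 : B1 = !![-α12, α12, α12; α21, -α21, α21; 0, 0, -2 * (α12 + α21)])
    (hB2 : B2 = !![-α12 / c1, -α12 / c1, -α12 / c1;
                   -α21 / c2, -α21 / c2, -α21 / c2;
                   α12 / c1 + α21 / c2, α12 / c1 + α21 / c2, α12 / c1 + α21 / c2])
    (B : ℕ → Matrix (Fin 3) (Fin 3) ℝ)
    (hB : ∀ N : ℕ, 1 ≤ N → B N = B1 + (1 / (N : ℝ)) • B2) :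
    ∃ N0 : ℕ, ∃ lam2 : ℕ → ℝ,
      (∀ N : ℕ, N0 ≤ N → ∃ u : Fin 3 → ℝ, u ≠ 0 ∧ B N *ᵥ u = lam2 N • u) ∧
      Tendsto (fun N : ℕ => (N : ℝ) * lam2 N) atTop (𝓝 (-κ2)) := by
  obtain ⟨E, hE⟩ : ∃ E : ℝ → ℝ, E = fun x => -(2 * (α12 + α21) + x) * (α12 / c1 * (2 * α21 + x)
      + α21 / c2 * (2 * α12 + x)) + (α12 / c1 + α21 / c2) * (2 * α12 + x) * (2 * α21 + x) :=
    ⟨_, rfl⟩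
  have hκpos : 0 < κ2 := by rw [hκ2, hZ]; positivity
  have hE0 : E 0 = -2 * (α12 + α21) ^ 2 * κ2 := by
    rw [hE, hκ2, hZ]; field_simp; ring
  have hE0' : E 0 ≠ 0 := by
    rw [hE0]
    have : 0 < (α12 + α21) ^ 2 * κ2 := by positivity
    linarith
  have hEd : ContDiff ℝ 1 E := by rw [hE]; fun_prop
  obtain ⟨G, hG⟩ : ∃ G : ℝ → ℝ, G = fun x => x * (x + (α12 + α21)) * (x + 2 * (α12 + α21)) :=
    ⟨_, rfl⟩
  have hGd : ContDiff ℝ 1 G := by rw [hG]; fun_prop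
  have hG0 : G 0 = 0 := by simp [hG]
  have hG' : HasStrictDerivAt G (2 * (α12 + α21) ^ 2) 0 := by
    rw [hG]
    have h := (((hasStrictDerivAt_id (0 : ℝ)).mul
      ((hasStrictDerivAt_id (0 : ℝ)).add_const (α12 + α21)))).mul
      ((hasStrictDerivAt_id (0 : ℝ)).add_const (2 * (α12 + α21)))
    refine HasStrictDerivAt.congr_deriv h ?_
    simp; ring
  have hE' : HasStrictDerivAt E (deriv E 0) 0 :=
    (hEd.contDiffAt).hasStrictDerivAt (by norm_num)
  have hg : HasStrictDerivAt (fun x => G x / E x) (-(1 / κ2)) 0 := by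
    refine HasStrictDerivAt.congr_deriv (hG'.div hE' hE0') ?_
    rw [hG0, hE0]
    field_simp
    ring
  have hne : -(1 / κ2) ≠ 0 := by
    have : 0 < 1 / κ2 := by positivity
    linarith
  have hinv := hg.to_localInverse hne
  have hright := (hg.hasStrictFDerivAt_equiv hne).eventually_right_inverse
  have hzero := (hg.hasStrictFDerivAt_equiv hne).localInverse_apply_image
  change HasStrictDerivAt ((hg.hasStrictFDerivAt_equiv hne).localInverse _ _ _) _ _ at hinv
  generalize (hg.hasStrictFDerivAt_equiv hne).localInverse _ _ _ = h at hinv hright hzero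
  simp only [hG0, zero_div] at hinv hright hzero
  have ht0 : Tendsto (fun N : ℕ => 1 / (N : ℝ)) atTop (𝓝 0) := tendsto_one_div_atTop_nhds_zero_nat
  obtain ⟨N1, hN1⟩ := eventually_atTop.1 (ht0.eventually hright)
  refine ⟨max N1 1, fun N => h (1 / N), ?_, ?_⟩
  · intro N hN
    have hN1' := hN1 N (le_trans (le_max_left _ _) hN)
    have hNpos : 1 ≤ N := le_trans (le_max_right _ _) hN
    have hNr : (0 : ℝ) < N := by exact_mod_cast hNpos
    have htp : 0 < 1 / (N : ℝ) := by positivity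
    rw [hB N hNpos]
    beta_reduce
    generalize 1 / (N : ℝ) = t at *
    generalize h t = x at *
    have hEx : E x ≠ 0 := by
      intro h0
      rw [h0, div_zero] at hN1'
      linarith
    have key : G x = t * E x := by
      rw [div_eq_iff hEx] at hN1'
      exact hN1'
    have hdet : (B1 + t • B2 - x • (1 : Matrix (Fin 3) (Fin 3) ℝ)).det = 0 := by
      have : (B1 + t • B2 - x • (1 : Matrix (Fin 3) (Fin 3) ℝ)).det = t * E x - G x := by
        rw [hB1, hB2, hE, hG, Matrix.det_fin_three]
        simp [neg_div]
        ring
      rw [this, key, sub_self]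
    obtain ⟨u, hu, hu2⟩ := Matrix.exists_mulVec_eq_zero_iff.2 hdet
    refine ⟨u, hu, ?_⟩
    rw [Matrix.sub_mulVec, Matrix.smul_mulVec, Matrix.one_mulVec, sub_eq_zero] at hu2
    exact hu2
  · have hs := hinv.hasDerivAt.tendsto_slope
    have ht : Tendsto (fun N : ℕ => 1 / (N : ℝ)) atTop (𝓝[≠] 0) := by
      refine tendsto_nhdsWithin_iff.2 ⟨ht0, ?_⟩
      filter_upwards [eventually_ge_atTop 1] with N hN
      have : (0 : ℝ) < N := by exact_mod_cast hN
      exact (by positivity : (1 / (N : ℝ)) ≠ 0)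
    have h2 := hs.comp ht
    have e : (-(1 / κ2))⁻¹ = -κ2 := by rw [inv_neg, one_div, inv_inv]
    rw [e] at h2
    refine h2.congr fun N => ?_
    simp [slope_def_field, hzero]
    ring
end

section
/- There exist a natural number N0 and a function σ2 assigning to each natural number N ≥ N0 a real eigenvalue σ2(N) of the matrix A(N), such that N²·(1 − σ2(N)) → κ2/Δ as N → ∞. -/
open Matrix Filter Topology

theorem root_branch (F : ℝ → ℝ → ℝ) (hF : Continuous (fun p : ℝ × ℝ => F p.1 p.2)) (L y0 : ℝ)
    (hL : 0 < L) (h0 : ∀ y, F 0 y = L * (y - y0)) :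
    ∃ t : ℝ → ℝ, (∀ᶠ e in 𝓝 (0:ℝ), F e (t e) = 0) ∧ Tendsto t (𝓝 0) (𝓝 y0) := by
  have hcy : ∀ e, Continuous (F e) := fun e => hF.comp (by fun_prop : Continuous fun y : ℝ => (e, y))
  have hce : ∀ y, Continuous (fun e => F e y) :=
    fun y => hF.comp (by fun_prop : Continuous fun e : ℝ => (e, y))
  have key : ∀ d > 0, ∀ᶠ e in 𝓝 (0:ℝ), ∃ y, F e y = 0 ∧ dist y0 y ≤ d := by
    intro d hd
    have h1 : ∀ᶠ e in 𝓝 (0:ℝ), 0 < F e (y0 + d) := by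
      apply (hce (y0 + d)).continuousAt.eventually_const_lt
      beta_reduce; rw [h0]; simp; positivity
    have h2 : ∀ᶠ e in 𝓝 (0:ℝ), F e (y0 - d) < 0 := by
      apply (hce (y0 - d)).continuousAt.eventually_lt_const
      beta_reduce; rw [h0]; nlinarith
    filter_upwards [h1, h2] with e h1 h2
    obtain ⟨y, hy, hy0⟩ := intermediate_value_Icc (by linarith : y0 - d ≤ y0 + d)
      (hcy e).continuousOn ⟨h2.le, h1.le⟩
    refine ⟨y, hy0, ?_⟩
    rw [Real.dist_eq, abs_le]
    constructor <;> linarith [hy.1, hy.2]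
  have near : ∀ e, ∃ y, (∃ z, F e z = 0) → F e y = 0 ∧ ∀ z, F e z = 0 → dist y0 y ≤ dist y0 z := by
    intro e
    by_cases h : ∃ z, F e z = 0
    · have hcl : IsClosed {z | F e z = 0} := isClosed_eq (hcy e) continuous_const
      obtain ⟨y, hy, hd⟩ := hcl.exists_infDist_eq_dist h y0
      exact ⟨y, fun _ => ⟨hy, fun z hz => hd ▸ Metric.infDist_le_dist_of_mem hz⟩⟩
    · exact ⟨0, fun h' => absurd h' h⟩
  choose t ht using near
  refine ⟨t, ?_, ?_⟩
  · filter_upwards [key 1 one_pos] with e he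
    obtain ⟨y, hy, _⟩ := he
    exact (ht e ⟨y, hy⟩).1
  · rw [Metric.tendsto_nhds]
    intro d hd
    filter_upwards [key (d/2) (by positivity)] with e he
    obtain ⟨y, hy, hyd⟩ := he
    have := (ht e ⟨y, hy⟩).2 y hy
    rw [dist_comm]; linarith

/-- The top eigenvalue `σ2(N)` of `A(N)` satisfies
`N²·(1 - σ2(N)) → κ2/Δ`. -/
theorem top_eigenvalue_sigma2
    (α12 α21 c1 c2 Δ Z κ2 : ℝ)
    (hα12 : 0 < α12) (hα21 : 0 < α21)
    (hc1 : 0 < c1) (hc2 : 0 < c2) (hc : c1 + c2 = 1)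
    (hΔ : Δ = c1 * α12 + c2 * α21)
    (hZ : Z = (α12 + α21) * (1 / α12 + 1 / α21))
    (hκ2 : κ2 = (2 / Z) * (α21 / c1 + α12 / c2))
    (B1 B2 : Matrix (Fin 3) (Fin 3) ℝ)
    (hB1 : B1 = !![-α12, α12, α12; α21, -α21, α21; 0, 0, -2 * (α12 + α21)])
    (hB2 : B2 = !![-α12 / c1, -α12 / c1, -α12 / c1;
                   -α21 / c2, -α21 / c2, -α21 / c2;
                   α12 / c1 + α21 / c2, α12 / c1 + α21 / c2, α12 / c1 + α21 / c2])
    (B A : ℕ → Matrix (Fin 3) (Fin 3) ℝ)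
    (hB : ∀ N : ℕ, 1 ≤ N → B N = B1 + (1 / (N : ℝ)) • B2)
    (hA : ∀ N : ℕ, 1 ≤ N → A N = 1 + (1 / ((N : ℝ) * Δ)) • B N) :
    ∃ N0 : ℕ, ∃ σ2 : ℕ → ℝ,
      (∀ N : ℕ, N0 ≤ N → ∃ u : Fin 3 → ℝ, u ≠ 0 ∧ A N *ᵥ u = σ2 N • u) ∧
      Tendsto (fun N : ℕ => (N : ℝ) ^ 2 * (1 - σ2 N)) atTop (𝓝 (κ2 / Δ)) := by
  have hs : 0 < α12 + α21 := by positivity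
  have hΔ0 : 0 < Δ := by rw [hΔ]; positivity
  obtain ⟨p, hp⟩ : ∃ p, p = α12 / c1 := ⟨_, rfl⟩
  obtain ⟨r, hr⟩ : ∃ r, r = α21 / c2 := ⟨_, rfl⟩
  have hκ : κ2 * (2 * (α12 + α21) ^ 2) =
      -(4 * α12 * α21 * (p + r) - 4 * (α12 + α21) * (α12 * r + α21 * p)) := by
    rw [hκ2, hZ, hp, hr]; field_simp; ring
  obtain ⟨t, ht, htl⟩ := root_branch
    (fun e t => t * α21 * (2 * (α12 + α21)) + (2 * α12 + e * t) *
        (-2 * α21 * (p + r) + α21 * t - (r + t) * (-(2 * (α12 + α21)) + e * (p + r) - e * t)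
          + e * r * (p + r))
      - t * (α12 - e * p) * (2 * (α12 + α21) + e * t)
      - 2 * α21 * (α12 * t - p * (2 * (α12 + α21)) - e * p * t))
    (by fun_prop) (2 * (α12 + α21) ^ 2) (-κ2) (by positivity)
    (by intro y; linear_combination -hκ)
  have hN : Tendsto (fun N : ℕ => 1 / (N : ℝ)) atTop (𝓝 0) := tendsto_one_div_atTop_nhds_zero_nat
  obtain ⟨N0, hN0⟩ := eventually_atTop.1 ((hN.eventually ht).and (eventually_ge_atTop 1))
  refine ⟨N0, fun N => 1 + (1 / (N : ℝ)) ^ 2 * t (1 / (N : ℝ)) / Δ, ?_, ?_⟩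
  · intro N hNN
    obtain ⟨hroot, hN1⟩ := hN0 N hNN
    have hNpos : (0:ℝ) < N := by exact_mod_cast hN1
    obtain ⟨e, he⟩ : ∃ e, e = 1 / (N : ℝ) := ⟨_, rfl⟩
    have hcoef : 1 / ((N : ℝ) * Δ) = e / Δ := by rw [he]; field_simp
    rw [hA N hN1, hB N hN1, hcoef]
    simp only [← he] at hroot ⊢
    generalize t e = y at hroot ⊢
    have hdet : (B1 + e • B2 - (e * y) • (1 : Matrix (Fin 3) (Fin 3) ℝ)).det = 0 := by
      rw [hB1, hB2, neg_div, neg_div, ← hp, ← hr, Matrix.det_fin_three]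
      simp [Matrix.one_apply]
      linear_combination (-e) * hroot
    obtain ⟨u, hu, hu0⟩ := Matrix.exists_mulVec_eq_zero_iff.2 hdet
    refine ⟨u, hu, ?_⟩
    rw [Matrix.sub_mulVec, Matrix.smul_mulVec, Matrix.one_mulVec, sub_eq_zero] at hu0
    rw [Matrix.add_mulVec, Matrix.smul_mulVec, Matrix.one_mulVec, hu0, smul_smul, add_smul, one_smul]
    congr 2
    ring
  · have h1 : Tendsto (fun N : ℕ => -t (1 / (N : ℝ)) / Δ) atTop (𝓝 (κ2 / Δ)) := by
      have := ((htl.comp hN).neg).div_const Δ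
      simpa using this
    refine h1.congr' ?_
    filter_upwards [eventually_ge_atTop 1] with N hN1
    have hNpos : (0:ℝ) < N := by exact_mod_cast hN1
    generalize t (1 / (N : ℝ)) = y
    field_simp
    ring
end

section
/- There exist a constant C > 0 and a natural number N0 such that for every natural number N ≥ N0 and every n ∈ ℕ, every entry of the matrix power A(N)^n has absolute value at most C. -/
open Matrix

def InvS (a b r d K L x y z : ℝ) : Prop :=
  |b * x + a * y + r * z| ≤ K ∧ |x - y + d * z| ≤ L ∧ |z| ≤ L

set_option maxHeartbeats 1000000 in
lemma InvS_step (a b e r d K L h ν s1 s2 s3 x y z x' y' z' : ℝ)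
    (ha : 0 < a) (hb : 0 < b) (he : e = a + b) (hr : r * e = a * b) (hd : d * e = a - b)
    (hK : K = L * e) (hL : 0 ≤ L) (hh : 0 ≤ h) (hν : 0 ≤ ν)
    (hκ : b * s1 + a * s2 + r * s3 ≤ 0)
    (h1 : h * ν * (-(b * s1 + a * s2 + r * s3)) * 2 ≤ e)
    (h2 : 2 * h * e ≤ 1)
    (h3 : ν * (4 * |s1 - s2 + d * s3|) ≤ e)
    (h4 : ν * (4 * |s3|) ≤ 2 * e)
    (hx : x' = x + h * (-a * x + a * y + a * z + ν * (s1 * (x + y + z))))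
    (hy : y' = y + h * (b * x - b * y + b * z + ν * (s2 * (x + y + z))))
    (hz : z' = z + h * (-2 * e * z + ν * (s3 * (x + y + z))))
    (H : InvS a b r d K L x y z) : InvS a b r d K L x' y' z' := by
  obtain ⟨H1, H2, H3⟩ := H
  have hepos : 0 < e := by rw [he]; positivity
  have hene := hepos.ne'
  set u := b * x + a * y + r * z with hu
  set v := x - y + d * z with hv
  set σ := x + y + z with hσ
  set κ := -(b * s1 + a * s2 + r * s3) with hκd
  set m := s1 - s2 + d * s3 with hm
  have hκ0 : 0 ≤ κ := by linarith
  have hσe : σ * e = 2 * u + d * e * v + 2 * r * z := by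
    rw [hu, hv, hσ]
    have : d * d * e * e = (a - b) * (a - b) := by rw [← hd]; ring
    have h5 : (σ * e - (2 * u + d * e * v + 2 * r * z)) * e = 0 := by
      rw [hu, hv, hσ]
      linear_combination (-4 * z) * hr - this * z + (x + y + z) * e * he - (x - y) * e * hd + z * (e + a + b) * he - (x + y + z) * e * he + (x + y) * e * he
    have h6 := (mul_eq_zero.mp h5).resolve_right hene
    linarith
  have hd1 : |d| ≤ 1 := by
    have : |d| * e ≤ 1 * e := by
      rw [← abs_of_pos hepos, ← abs_mul, hd, abs_of_pos hepos, abs_le]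
      constructor <;> linarith
    exact le_of_mul_le_mul_right this hepos
  have hr0 : 0 ≤ r := by
    have : 0 < r * e := by rw [hr]; positivity
    exact (pos_of_mul_pos_left this hepos.le).le
  have hr1 : 2 * r ≤ e := by
    have : (2 * r) * e ≤ e * e := by
      have : (2 * r) * e = 2 * (a * b) := by linear_combination 2 * hr
      rw [this, he]; nlinarith
    exact le_of_mul_le_mul_right this hepos
  have hu' : b * x' + a * y' + r * z' = u - h * ν * κ * σ := by
    rw [hx, hy, hz, hu, hκd]; linear_combination (-2 * h * z) * hr
  have hv' : x' - y' + d * z' = v - h * e * v + h * ν * (m * σ) := by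
    rw [hx, hy, hz, hv, hm]; linear_combination (h * (x - y)) * he - h * z * hd
  obtain ⟨ρ, hρ⟩ : ∃ ρ, ρ = d * v + 2 * r * z / e := ⟨_, rfl⟩
  have hσ2 : σ = 2 * u / e + ρ := by
    rw [hρ]; field_simp; linarith
  have hρL : |ρ| ≤ 2 * L := by
    have e1 : |d * v| ≤ 1 * L := by rw [abs_mul]; gcongr
    have e2 : |2 * r * z / e| ≤ L := by
      rw [abs_div, abs_mul, abs_of_pos hepos, abs_of_nonneg (by positivity : 0 ≤ 2 * r), div_le_iff₀ hepos, mul_comm L]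
      gcongr
    rw [hρ]; have := abs_add_le (d * v) (2 * r * z / e); linarith
  have hue : |2 * u / e| ≤ 2 * L := by
    rw [abs_div, abs_mul, abs_of_pos hepos, div_le_iff₀ hepos]; rw [abs_of_pos (two_pos : (0:ℝ) < 2)]; linarith
  have hσL : |σ| ≤ 4 * L := by
    rw [hσ2]; have := abs_add_le (2 * u / e) ρ; linarith
  have key : ∀ q p w : ℝ, 0 ≤ p → h * p ≤ 1 → ν * (4 * |q|) ≤ p → |w| ≤ L →
      |w - h * p * w + h * ν * (q * σ)| ≤ L := by
    intro q p w hp hp1 hq hw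
    have e1 : |(1 - h * p) * w| ≤ (1 - h * p) * L := by
      rw [abs_mul, abs_of_nonneg (by linarith)]
      exact mul_le_mul_of_nonneg_left hw (by linarith)
    have e2 : |h * ν * (q * σ)| ≤ h * p * L := by
      rw [abs_mul, abs_mul q, abs_of_nonneg (by positivity : 0 ≤ h * ν)]
      calc h * ν * (|q| * |σ|) ≤ h * ν * (|q| * (4 * L)) := by gcongr
        _ = h * (ν * (4 * |q|)) * L := by ring
        _ ≤ h * p * L := by gcongr
    have := abs_add_le ((1 - h * p) * w) (h * ν * (q * σ))
    have e3 : w - h * p * w + h * ν * (q * σ) = (1 - h * p) * w + h * ν * (q * σ) := by ring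
    rw [e3]; linarith
  refine ⟨?_, ?_, ?_⟩
  · have e0 : u - h * ν * κ * σ = (1 - h * ν * κ * 2 / e) * u + -(h * ν * κ * ρ) := by
      rw [hσ2]; field_simp; ring
    have hle : h * ν * κ * 2 / e ≤ 1 := by rw [div_le_one hepos]; exact h1
    have e1 : |(1 - h * ν * κ * 2 / e) * u| ≤ (1 - h * ν * κ * 2 / e) * K := by
      rw [abs_mul, abs_of_nonneg (by linarith)]
      exact mul_le_mul_of_nonneg_left H1 (by linarith)
    have e2 : |-(h * ν * κ * ρ)| ≤ h * ν * κ * (2 * L) := by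
      rw [abs_neg, abs_mul, abs_of_nonneg (by positivity)]; gcongr
    have e3 : (1 - h * ν * κ * 2 / e) * K = K - h * ν * κ * (2 * L) := by
      rw [hK]; field_simp
    rw [hu', e0]
    have := abs_add_le ((1 - h * ν * κ * 2 / e) * u) (-(h * ν * κ * ρ))
    linarith
  · rw [hv']; exact key m e v hepos.le (by linarith [mul_nonneg hh hepos.le]) h3 H2
  · have : z' = z - h * (2 * e) * z + h * ν * (s3 * σ) := by rw [hz, hσ]; ring
    rw [this]; exact key s3 (2 * e) z (by positivity) (by linarith) h4 H3

lemma InvS_bound (a b e r d K L x y z : ℝ)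
    (ha : 0 < a) (hb : 0 < b) (he : e = a + b) (hr : r * e = a * b) (hd : d * e = a - b)
    (hK : K = L * e) (hL : 0 ≤ L)
    (H : InvS a b r d K L x y z) :
    |x| ≤ (K + r * L + 2 * e * L) / e ∧ |y| ≤ (K + r * L + 2 * e * L) / e ∧
    |z| ≤ (K + r * L + 2 * e * L) / e := by
  obtain ⟨H1, H2, H3⟩ := H
  have hepos : 0 < e := by rw [he]; positivity
  have hr0 : 0 ≤ r := by
    have : 0 < r * e := by rw [hr]; positivity
    exact (pos_of_mul_pos_left this hepos.le).le
  have hd1 : |d| ≤ 1 := by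
    have : |d| * e ≤ 1 * e := by
      rw [← abs_of_pos hepos, ← abs_mul, hd, abs_of_pos hepos, abs_le]
      constructor <;> linarith
    exact le_of_mul_le_mul_right this hepos
  have hrz : |r * z| ≤ r * L := by rw [abs_mul, abs_of_nonneg hr0]; gcongr
  have hdz : |d * z| ≤ 1 * L := by rw [abs_mul]; gcongr
  have hxy : |x - y| ≤ 2 * L := by
    rw [abs_le] at *; constructor <;> linarith
  have hs : |b * x + a * y| ≤ K + r * L := by
    rw [abs_le] at *; constructor <;> linarith
  have ha2 : |a * (x - y)| ≤ e * (2 * L) := by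
    rw [abs_mul, abs_of_pos ha]; gcongr; linarith
  have hb2 : |b * (x - y)| ≤ e * (2 * L) := by
    rw [abs_mul, abs_of_pos hb]; gcongr; linarith
  refine ⟨?_, ?_, ?_⟩
  · rw [le_div_iff₀ hepos]
    have : |x| * e = |b * x + a * y + a * (x - y)| := by
      nth_rewrite 1 [← abs_of_pos hepos]; rw [← abs_mul, he]; ring_nf
    rw [this]; have := abs_add_le (b * x + a * y) (a * (x - y)); linarith
  · rw [le_div_iff₀ hepos]
    have : |y| * e = |b * x + a * y - b * (x - y)| := by
      nth_rewrite 1 [← abs_of_pos hepos]; rw [← abs_mul, he]; ring_nf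
    rw [this]; have := abs_sub (b * x + a * y) (b * (x - y)); linarith
  · rw [le_div_iff₀ hepos, hK]
    have : |z| * e ≤ L * e := by gcongr
    have : 0 ≤ r * L := by positivity
    have : 0 ≤ L * e := by positivity
    linarith

/-- The powers `A(N)^n` are bounded entrywise, uniformly in `n` and `N`. -/
theorem A_powers_uniformly_bounded
    (α12 α21 c1 c2 Δ : ℝ)
    (hα12 : 0 < α12) (hα21 : 0 < α21)
    (hc1 : 0 < c1) (hc2 : 0 < c2) (hc : c1 + c2 = 1)
    (hΔ : Δ = c1 * α12 + c2 * α21)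
    (B1 B2 : Matrix (Fin 3) (Fin 3) ℝ)
    (hB1 : B1 = !![-α12, α12, α12; α21, -α21, α21; 0, 0, -2 * (α12 + α21)])
    (hB2 : B2 = !![-α12 / c1, -α12 / c1, -α12 / c1;
                   -α21 / c2, -α21 / c2, -α21 / c2;
                   α12 / c1 + α21 / c2, α12 / c1 + α21 / c2, α12 / c1 + α21 / c2])
    (B A : ℕ → Matrix (Fin 3) (Fin 3) ℝ)
    (hB : ∀ N : ℕ, 1 ≤ N → B N = B1 + (1 / (N : ℝ)) • B2)
    (hA : ∀ N : ℕ, 1 ≤ N → A N = 1 + (1 / ((N : ℝ) * Δ)) • B N) :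
    ∃ C > (0 : ℝ), ∃ N0 : ℕ,
      ∀ N : ℕ, N0 ≤ N → ∀ n : ℕ, ∀ i j : Fin 3, |(A N ^ n) i j| ≤ C := by
  obtain ⟨e, he⟩ : ∃ e, e = α12 + α21 := ⟨_, rfl⟩
  have hepos : 0 < e := by rw [he]; positivity
  have hΔpos : 0 < Δ := by rw [hΔ]; positivity
  obtain ⟨r, hr'⟩ : ∃ r, r = α12 * α21 / e := ⟨_, rfl⟩
  obtain ⟨d, hd'⟩ : ∃ d, d = (α12 - α21) / e := ⟨_, rfl⟩
  have hr : r * e = α12 * α21 := by rw [hr']; field_simp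
  have hd : d * e = α12 - α21 := by rw [hd']; field_simp
  have hr0 : 0 < r := by rw [hr']; positivity
  obtain ⟨s1, hs1⟩ : ∃ s, s = -α12 / c1 := ⟨_, rfl⟩
  obtain ⟨s2, hs2⟩ : ∃ s, s = -α21 / c2 := ⟨_, rfl⟩
  obtain ⟨s3, hs3⟩ : ∃ s, s = α12 / c1 + α21 / c2 := ⟨_, rfl⟩
  have hκ : α21 * s1 + α12 * s2 + r * s3 ≤ 0 := by
    have h0 : α21 * s1 + α12 * s2 + r * s3 = -(r * (α21 / c1 + α12 / c2)) := by
      rw [hs1, hs2, hs3, hr', he]; field_simp; ring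
    rw [h0]; have : 0 < r * (α21 / c1 + α12 / c2) := by positivity
    linarith
  rw [← hs1, ← hs2, ← hs3] at hB2
  obtain ⟨κ, hκd⟩ : ∃ κ, κ = -(α21 * s1 + α12 * s2 + r * s3) := ⟨_, rfl⟩
  obtain ⟨L, hL⟩ : ∃ L, L = (e + r) / e := ⟨_, rfl⟩
  have hL1 : 1 ≤ L := by rw [hL, le_div_iff₀ hepos]; linarith
  have hK : e + r = L * e := by rw [hL]; field_simp
  refine ⟨((e + r) + r * L + 2 * e * L) / e, by positivity, ?_⟩
  obtain ⟨N0, hN0⟩ := exists_nat_ge (1 + 2 * κ / (Δ * e) + 2 * e / Δ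
    + 4 * |s1 - s2 + d * s3| / e + 4 * |s3| / (2 * e))
  refine ⟨N0, fun N hN n => ?_⟩
  have hNr : (N0 : ℝ) ≤ N := by exact_mod_cast hN
  have hκ0 : 0 ≤ κ := by linarith
  have p1 : 0 ≤ 2 * κ / (Δ * e) := by positivity
  have p2 : 0 ≤ 2 * e / Δ := by positivity
  have p3 : 0 ≤ 4 * |s1 - s2 + d * s3| / e := by positivity
  have p4 : 0 ≤ 4 * |s3| / (2 * e) := by positivity
  have hN1 : (1 : ℝ) ≤ N := by linarith
  have hN1' : 1 ≤ N := by exact_mod_cast hN1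
  have hNpos : (0 : ℝ) < N := by linarith
  have q1 : 2 * κ / (Δ * e) ≤ N := by linarith
  have q2 : 2 * e / Δ ≤ N := by linarith
  have q3 : 4 * |s1 - s2 + d * s3| / e ≤ N := by linarith
  have q4 : 4 * |s3| / (2 * e) ≤ N := by linarith
  rw [div_le_iff₀ (by positivity)] at q1 q2 q3 q4
  have main : ∀ j, InvS α12 α21 r d (e + r) L ((A N ^ n) 0 j) ((A N ^ n) 1 j) ((A N ^ n) 2 j) := by
    induction n with
    | zero =>
      have hd1 : |d| ≤ 1 := by
        have : |d| * e ≤ 1 * e := by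
          rw [← abs_of_pos hepos, ← abs_mul, hd, abs_of_pos hepos, abs_le]
          constructor <;> linarith
        exact le_of_mul_le_mul_right this hepos
      intro j
      fin_cases j <;> simp [InvS, abs_of_pos hα12, abs_of_pos hα21, abs_of_pos hr0] <;>
        refine ⟨?_, ?_⟩ <;> first | linarith | (refine ⟨?_, ?_⟩ <;> linarith)
    | succ n ih =>
      intro j
      refine InvS_step α12 α21 e r d (e + r) L (1 / (N * Δ)) (1 / N) s1 s2 s3 _ _ _ _ _ _
        hα12 hα21 he hr hd hK (by linarith) (by positivity) (by positivity) hκ ?_ ?_ ?_ ?_ ?_ ?_ ?_ (ih j)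
      · rw [← hκd]
        have : 1 / (N * Δ) * (1 / (N : ℝ)) * κ * 2 = (2 * κ) / (N * Δ * N) := by field_simp
        rw [this, div_le_iff₀ (by positivity)]
        have : (N : ℝ) * (Δ * e) ≤ N * (Δ * e) * N := le_mul_of_one_le_right (by positivity) hN1
        linarith
      · have : 2 * (1 / (N * Δ)) * e = (2 * e) / (N * Δ) := by field_simp
        rw [this, div_le_one (by positivity)]; exact q2
      · rw [one_div_mul_eq_div, div_le_iff₀ hNpos]; linarith
      · rw [one_div_mul_eq_div, div_le_iff₀ hNpos]; linarith
      all_goals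
        rw [pow_succ', Matrix.mul_apply, Fin.sum_univ_three, hA N hN1', hB N hN1', hB1, hB2]
        simp [Matrix.one_apply]
        try rw [he]
        ring
  intro i j
  have := InvS_bound α12 α21 e r d (e + r) L _ _ _ hα12 hα21 he hr hd hK (by linarith) (main j)
  fin_cases i
  · exact this.1
  · exact this.2.1
  · exact this.2.2
end

section
/- Let l0 < 0 and fix γ0 with 0 < γ0 < 1/(α12 + α21). Then there exist constants C1 > C2 > 0 such that for every γ with 0 < γ ≤ γ0 and every n ∈ ℕ, the solution l of the mean-difference recurrence with parameter γ and initial value l(0) = l0 satisfies C2 < (v1 − v2)·l(n) < C1. -/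
/-- Uniform two-sided bounds on `(v1 - v2)·l(n)` for solutions of the
mean-difference recurrence with negative initial value, uniformly in `n`
and in the parameter `γ ∈ (0, γ0]`. -/
theorem uniform_bounds_on_vl
    (α12 α21 v1 v2 l0 γ0 : ℝ)
    (hα12 : 0 < α12) (hα21 : 0 < α21) (hv : v1 < v2)
    (hl0 : l0 < 0) (hγ0pos : 0 < γ0) (hγ0lt : γ0 < 1 / (α12 + α21)) :
    ∃ C1 C2 : ℝ, 0 < C2 ∧ C2 < C1 ∧
      ∀ γ : ℝ, 0 < γ → γ ≤ γ0 →
        ∀ l : ℕ → ℝ,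
          (∀ n, l (n + 1) = (1 - γ * (α12 + α21)) * l n
              + γ * (v1 - v2) * (1 - γ * (α12 + α21))) →
          l 0 = l0 →
          ∀ n : ℕ, C2 < (v1 - v2) * l n ∧ (v1 - v2) * l n < C1 := by
  obtain ⟨a, ha⟩ : ∃ a, a = α12 + α21 := ⟨_, rfl⟩
  rw [← ha] at hγ0lt ⊢
  have hapos : 0 < a := by linarith
  obtain ⟨K, hK⟩ : ∃ K, K = (v1 - v2) ^ 2 / a := ⟨_, rfl⟩
  have hd : 0 < (v1 - v2) ^ 2 := by
    have : v1 - v2 < 0 := by linarith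
    nlinarith
  have hKpos : 0 < K := by rw [hK]; positivity
  have hKa : (v1 - v2) ^ 2 = K * a := by rw [hK]; field_simp
  have hR0 : 0 < 1 - γ0 * a := by
    have := (lt_div_iff₀ hapos).1 hγ0lt
    linarith
  have hw0 : 0 < (v1 - v2) * l0 := mul_pos_of_neg_of_neg (by linarith) hl0
  obtain ⟨m, hm⟩ : ∃ m, m = min ((v1 - v2) * l0) (K * (1 - γ0 * a)) := ⟨_, rfl⟩
  obtain ⟨M, hM⟩ : ∃ M, M = max ((v1 - v2) * l0) K := ⟨_, rfl⟩
  have hmpos : 0 < m := by rw [hm]; exact lt_min hw0 (by positivity)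
  have hm1 : m ≤ (v1 - v2) * l0 := hm ▸ min_le_left _ _
  have hm2 : m ≤ K * (1 - γ0 * a) := hm ▸ min_le_right _ _
  have hM1 : (v1 - v2) * l0 ≤ M := hM ▸ le_max_left _ _
  have hM2 : K ≤ M := hM ▸ le_max_right _ _
  refine ⟨M + 1, m / 2, by linarith, by linarith, ?_⟩
  intro γ hγ hγle l hrec h0 n
  have hRR : 1 - γ0 * a ≤ 1 - γ * a := by
    have := mul_le_mul_of_nonneg_right hγle hapos.le
    linarith
  have hga : 0 < γ * a := by positivity
  have hR : 0 < 1 - γ * a := by linarith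
  have key : m ≤ (v1 - v2) * l n ∧ (v1 - v2) * l n ≤ M := by
    induction n with
    | zero => rw [h0]; exact ⟨hm1, hM1⟩
    | succ n ih =>
      have e : (v1 - v2) * l (n + 1) =
          (1 - γ * a) * ((v1 - v2) * l n) + (γ * a) * (K * (1 - γ * a)) := by
        rw [hrec n]
        linear_combination γ * (1 - γ * a) * hKa
      have b1 : m ≤ K * (1 - γ * a) :=
        hm2.trans (mul_le_mul_of_nonneg_left hRR hKpos.le)
      have b2 : K * (1 - γ * a) ≤ M := by
        have : 0 < K * (γ * a) := by positivity
        linarith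
      have c1 := mul_le_mul_of_nonneg_left ih.1 hR.le
      have c2 := mul_le_mul_of_nonneg_left ih.2 hR.le
      have c3 := mul_le_mul_of_nonneg_left b1 hga.le
      have c4 := mul_le_mul_of_nonneg_left b2 hga.le
      rw [e]
      constructor <;> linarith
  exact ⟨by linarith [key.1], by linarith [key.2]⟩
end

section
/- Let b1, b2 > 0 and let θ : ℕ → ℝ be a sequence with θ(N) > 0 for all N and θ(N) → ∞ as N → ∞. For N large enough that 0 < 1 − b1/N < 1 and 0 < 1 − b2/N² < 1, set σ1(N) = 1 − b1/N, σ2(N) = 1 − b2/N², and n(N) = ⌈N·θ(N)⌉. Then the ratio [ (1 − σ1(N)^{n(N)})/(1 − σ1(N)) ] / [ (1 − σ2(N)^{n(N)})/(1 − σ2(N)) ] tends to 0 as N → ∞. -/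
open Filter Topology

/-- Perron–Frobenius dominance: for `n(N) = ⌈N·θ(N)⌉` with `θ(N) → ∞`, the
geometric sum of `σ1(N) = 1 - b1/N` is negligible compared with the geometric
sum of `σ2(N) = 1 - b2/N²`. -/
theorem geometric_sum_dominance
    (b1 b2 : ℝ) (hb1 : 0 < b1) (hb2 : 0 < b2)
    (θ : ℕ → ℝ) (hθpos : ∀ N, 0 < θ N)
    (hθ : Tendsto θ atTop atTop)
    (σ1 σ2 : ℕ → ℝ) (n : ℕ → ℕ)
    (hσ1 : ∀ N : ℕ, 0 < 1 - b1 / (N : ℝ) → σ1 N = 1 - b1 / (N : ℝ))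
    (hσ2 : ∀ N : ℕ, 0 < 1 - b2 / ((N : ℝ) ^ 2) → σ2 N = 1 - b2 / ((N : ℝ) ^ 2))
    (hn : ∀ N : ℕ, n N = ⌈(N : ℝ) * θ N⌉₊) :
    Tendsto (fun N : ℕ =>
        ((1 - σ1 N ^ n N) / (1 - σ1 N)) / ((1 - σ2 N ^ n N) / (1 - σ2 N)))
      atTop (𝓝 0) := by
  have hNat : Tendsto (fun N : ℕ => (N : ℝ)) atTop atTop := tendsto_natCast_atTop_atTop
  have hlim : Tendsto (fun N : ℕ => b1⁻¹ * (θ N)⁻¹ + b2 / b1 * ((N : ℝ))⁻¹) atTop (𝓝 0) := by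
    have h1 := (tendsto_inv_atTop_zero.comp hθ).const_mul b1⁻¹
    have h2 := (tendsto_inv_atTop_zero.comp hNat).const_mul (b2 / b1)
    simpa using h1.add h2
  have key : ∀ᶠ N : ℕ in atTop,
      0 ≤ ((1 - σ1 N ^ n N) / (1 - σ1 N)) / ((1 - σ2 N ^ n N) / (1 - σ2 N)) ∧
      ((1 - σ1 N ^ n N) / (1 - σ1 N)) / ((1 - σ2 N ^ n N) / (1 - σ2 N)) ≤
        b1⁻¹ * (θ N)⁻¹ + b2 / b1 * ((N : ℝ))⁻¹ := by
    filter_upwards [hNat.eventually_gt_atTop b1, hNat.eventually_gt_atTop b2,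
      hNat.eventually_gt_atTop 1] with N h1 h2 h3
    have hN : (0 : ℝ) < N := by linarith
    have hy1 : b1 / (N : ℝ) < 1 := (div_lt_one hN).2 h1
    have hx1 : b2 / ((N : ℝ) ^ 2) < 1 := (div_lt_one (by positivity)).2 (by nlinarith)
    rw [hσ1 N (by linarith), hσ2 N (by linarith)]
    have hnθ : (N : ℝ) * θ N ≤ n N := by rw [hn]; exact Nat.le_ceil _
    have hθN := hθpos N
    generalize n N = m at *
    have hm : (0 : ℝ) < m := lt_of_lt_of_le (by positivity) hnθ
    have hx0 : 0 < b2 / ((N : ℝ) ^ 2) := by positivity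
    have hy0 : 0 < b1 / (N : ℝ) := by positivity
    have hnum0 : 0 ≤ (1 - (1 - b1 / (N : ℝ)) ^ m) :=
      sub_nonneg.2 (pow_le_one₀ (by linarith) (by linarith))
    have hnum1 : (1 - (1 - b1 / (N : ℝ)) ^ m) ≤ 1 := by
      have : 0 ≤ (1 - b1 / (N : ℝ)) ^ m := pow_nonneg (by linarith) _
      linarith
    rw [sub_sub_cancel, sub_sub_cancel]
    have hden : (m : ℝ) / (1 + m * (b2 / (N : ℝ) ^ 2)) ≤
        (1 - (1 - b2 / (N : ℝ) ^ 2) ^ m) / (b2 / (N : ℝ) ^ 2) := by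
      generalize b2 / (N : ℝ) ^ 2 = x at *
      have hB : 1 + (m : ℝ) * x ≤ (1 + x) ^ m := one_add_mul_le_pow (by linarith) m
      have hP : (1 - x) ^ m * (1 + x) ^ m ≤ 1 := by
        rw [← mul_pow]
        exact pow_le_one₀ (by nlinarith) (by nlinarith)
      have hp : 0 ≤ (1 - x) ^ m := pow_nonneg (by linarith) _
      have := mul_le_mul_of_nonneg_left hB hp
      rw [div_le_div_iff₀ (by positivity) hx0]
      nlinarith
    have hd0 : 0 < (m : ℝ) / (1 + m * (b2 / (N : ℝ) ^ 2)) := by positivity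
    refine ⟨div_nonneg (div_nonneg hnum0 hy0.le) (hd0.le.trans hden), ?_⟩
    calc _ ≤ (1 / (b1 / (N : ℝ))) / ((m : ℝ) / (1 + m * (b2 / (N : ℝ) ^ 2))) := by
          apply div_le_div₀ (by positivity) _ hd0 hden
          exact div_le_div_of_nonneg_right hnum1 hy0.le
      _ = b1⁻¹ * (N / m) + b2 / b1 * ((N : ℝ))⁻¹ := by
          field_simp
      _ ≤ _ := by
          have : (N : ℝ) / m ≤ (θ N)⁻¹ := by
            rw [inv_eq_one_div, div_le_div_iff₀ hm hθN]; linarith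
          gcongr
  exact squeeze_zero' (key.mono fun _ h => h.1) (key.mono fun _ h => h.2) hlim
end
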